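/- arXiv:0902.1324 — 7 statements merged into one kernel-verified Lean document; each statement's English description precedes it below -/
import Mathlib

section
/- Weak duality holds for the eigenvalue relaxation: for every u ∈ ℝ^{n+1} and every x ∈ {−1,1}^{n+1}, θ(u) ≥ −xᵀMx; consequently inf{ θ(u) : u ∈ ℝ^{n+1} } ≥ opt(BLS). -/
open Matrix

noncomputable section

/-- The largest eigenvalue of a real (symmetric) matrix, i.e. the supremum of its spectrum. -/
def lamMax {k : Type*} [Fintype k] [DecidableEq k] (S : Matrix k k ℝ) : ℝ :=
  sSup (spectrum ℝ S)

/-- The block matrix `M = [[AᵀA + νP, −Aᵀy], [−yᵀA, yᵀy]]`, acting on `ℝ^{n+1} = ℝ^n ⊕ ℝ`. -/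
def Mmat {m n : ℕ} (A : Matrix (Fin m) (Fin n) ℝ) (y : Fin m → ℝ) (ν : ℝ)
    (P : Matrix (Fin n) (Fin n) ℝ) : Matrix (Fin n ⊕ Unit) (Fin n ⊕ Unit) ℝ :=
  Matrix.fromBlocks (Aᵀ * A + ν • P)
    (Matrix.of fun i (_ : Unit) => -(Aᵀ *ᵥ y) i)
    (Matrix.of fun (_ : Unit) j => -(Aᵀ *ᵥ y) j)
    (Matrix.of fun _ _ => y ⬝ᵥ y)

/-- The matrix `A(u) = D(u) − M − (uᵀe/(n+1))·I`. -/
def Amat {m n : ℕ} (A : Matrix (Fin m) (Fin n) ℝ) (y : Fin m → ℝ) (ν : ℝ)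
    (P : Matrix (Fin n) (Fin n) ℝ) (u : Fin n ⊕ Unit → ℝ) :
    Matrix (Fin n ⊕ Unit) (Fin n ⊕ Unit) ℝ :=
  Matrix.diagonal u - Mmat A y ν P - ((u ⬝ᵥ (fun _ => 1)) / (n + 1 : ℝ)) • 1

/-- The dual function `θ(u) = (n+1)·λmax(A(u))`. -/
def theta {m n : ℕ} (A : Matrix (Fin m) (Fin n) ℝ) (y : Fin m → ℝ) (ν : ℝ)
    (P : Matrix (Fin n) (Fin n) ℝ) (u : Fin n ⊕ Unit → ℝ) : ℝ :=
  (n + 1 : ℝ) * lamMax (Amat A y ν P u)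

/-- The set of values `−xᵀMx` over binary vectors `x ∈ {−1,1}^{n+1}`;
its supremum (a maximum) is `opt(BLS)`. -/
def BLSvals {n : ℕ} (M : Matrix (Fin n ⊕ Unit) (Fin n ⊕ Unit) ℝ) : Set ℝ :=
  {t | ∃ x : Fin n ⊕ Unit → ℝ, (∀ i, x i = 1 ∨ x i = -1) ∧ t = -(x ⬝ᵥ (M *ᵥ x))}

/-- The quadratic form of a symmetric matrix is bounded by its largest eigenvalue. -/
theorem dotProduct_mulVec_le_lamMax {k : Type*} [Fintype k] [DecidableEq k]
    {S : Matrix k k ℝ} (hS : S.IsSymm) (x : k → ℝ) :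
    x ⬝ᵥ (S *ᵥ x) ≤ lamMax S * (x ⬝ᵥ x) := by
  have hps : (algebraMap ℝ (Matrix k k ℝ) (lamMax S) - S).PosSemidef := by
    rw [Matrix.posSemidef_iff_isHermitian_and_spectrum_nonneg]
    constructor
    · simp [Matrix.IsHermitian, Matrix.algebraMap_eq_diagonal, hS.eq,
        Matrix.conjTranspose_eq_transpose_of_trivial]
    · rw [← spectrum.singleton_sub_eq]
      rintro _ ⟨_, rfl, t, ht, rfl⟩
      exact sub_nonneg.2 (le_csSup (Matrix.finite_real_spectrum (A := S)).bddAbove ht)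
  have h := hps.dotProduct_mulVec_nonneg x
  rw [star_trivial, Matrix.sub_mulVec, dotProduct_sub, Algebra.algebraMap_eq_smul_one,
    Matrix.smul_mulVec, Matrix.one_mulVec, dotProduct_smul, smul_eq_mul] at h
  linarith

theorem isSymm_Mmat {m n : ℕ} (A : Matrix (Fin m) (Fin n) ℝ) (y : Fin m → ℝ) (ν : ℝ)
    {P : Matrix (Fin n) (Fin n) ℝ} (hP : P.IsSymm) : (Mmat A y ν P).IsSymm := by
  have hA : (Aᵀ * A).IsSymm := by simp [Matrix.IsSymm, Matrix.transpose_mul]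
  exact Matrix.IsSymm.fromBlocks (hA.add (hP.smul ν)) rfl rfl

theorem isSymm_Amat {m n : ℕ} (A : Matrix (Fin m) (Fin n) ℝ) (y : Fin m → ℝ) (ν : ℝ)
    {P : Matrix (Fin n) (Fin n) ℝ} (hP : P.IsSymm) (u : Fin n ⊕ Unit → ℝ) :
    (Amat A y ν P u).IsSymm :=
  ((Matrix.isSymm_diagonal u).sub (isSymm_Mmat A y ν hP)).sub (Matrix.isSymm_one.smul _)

/-- Weak duality: for every `u` and every binary `x`, `θ(u) ≥ −xᵀMx`;
consequently `inf θ ≥ opt(BLS)`. -/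
theorem weak_duality {m n : ℕ} (A : Matrix (Fin m) (Fin n) ℝ) (y : Fin m → ℝ)
    (ν : ℝ) (hν : 0 ≤ ν) (P : Matrix (Fin n) (Fin n) ℝ) (hP : P.IsSymm) :
    (∀ (u : Fin n ⊕ Unit → ℝ) (x : Fin n ⊕ Unit → ℝ), (∀ i, x i = 1 ∨ x i = -1) →
        -(x ⬝ᵥ (Mmat A y ν P *ᵥ x)) ≤ theta A y ν P u) ∧
      sSup (BLSvals (Mmat A y ν P)) ≤ sInf (Set.range (theta A y ν P)) := by
  have hle : ∀ (u : Fin n ⊕ Unit → ℝ) (x : Fin n ⊕ Unit → ℝ), (∀ i, x i = 1 ∨ x i = -1) →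
      -(x ⬝ᵥ (Mmat A y ν P *ᵥ x)) ≤ theta A y ν P u := by
    intro u x hx
    have hsq : ∀ i, x i * x i = 1 := fun i => by rcases hx i with h | h <;> simp [h]
    have hxx : x ⬝ᵥ x = n + 1 := by simp [dotProduct, hsq]
    have hdiag : x ⬝ᵥ (Matrix.diagonal u *ᵥ x) = u ⬝ᵥ fun _ => 1 := by
      simp only [dotProduct, Matrix.mulVec_diagonal]
      exact Finset.sum_congr rfl fun i _ => by rw [mul_left_comm, hsq]
    have hn : (n + 1 : ℝ) ≠ 0 := by positivity
    have h := dotProduct_mulVec_le_lamMax (isSymm_Amat A y ν hP u) x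
    have hquad : x ⬝ᵥ (Amat A y ν P u *ᵥ x) = -(x ⬝ᵥ (Mmat A y ν P *ᵥ x)) := by
      rw [Amat, Matrix.sub_mulVec, Matrix.sub_mulVec, dotProduct_sub, dotProduct_sub,
        Matrix.smul_mulVec, Matrix.one_mulVec, dotProduct_smul, smul_eq_mul, hdiag, hxx,
        div_mul_cancel₀ _ hn]
      ring
    rwa [hquad, hxx, mul_comm] at h
  refine ⟨hle, csSup_le ⟨_, fun _ => 1, fun _ => Or.inl rfl, rfl⟩ ?_⟩
  rintro _ ⟨x, hx, rfl⟩
  refine le_csInf (Set.range_nonempty _) ?_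
  rintro _ ⟨u, rfl⟩
  exact hle u x hx
end
end

section
/- The dual function θ admits a minimizer: there exists u* ∈ ℝ^{n+1} such that θ(u*) ≤ θ(u) for all u ∈ ℝ^{n+1}. -/
open Matrix

noncomputable section

/-- The largest eigenvalue of a symmetric matrix is at most `t` iff the quadratic form of the
matrix is bounded by `t` times the squared Euclidean norm. -/
theorem lamMax_le_iff {k : Type*} [Fintype k] [DecidableEq k] [Nonempty k] {S : Matrix k k ℝ}
    (hS : S.IsSymm) (t : ℝ) :
    lamMax S ≤ t ↔ ∀ x : k → ℝ, x ⬝ᵥ (S *ᵥ x) ≤ t * (x ⬝ᵥ x) := by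
  have hS' : S.IsHermitian := hS
  have hT : (algebraMap ℝ (Matrix k k ℝ) t - S).IsHermitian := by
    refine IsHermitian.sub ?_ hS'
    rw [Algebra.algebraMap_eq_smul_one]
    exact Matrix.isHermitian_one.smul (IsSelfAdjoint.all t)
  have hspec : lamMax S ≤ t ↔ ∀ s ∈ spectrum ℝ S, s ≤ t := by
    rw [lamMax, hS'.spectrum_real_eq_range_eigenvalues]
    exact csSup_le_iff (Set.finite_range _).bddAbove (Set.range_nonempty _)
  have hpos : (∀ s ∈ spectrum ℝ S, s ≤ t) ↔ (algebraMap ℝ (Matrix k k ℝ) t - S).PosSemidef := by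
    have h : (∀ s ∈ spectrum ℝ (algebraMap ℝ (Matrix k k ℝ) t - S), 0 ≤ s) ↔
        ∀ s ∈ spectrum ℝ S, s ≤ t := by
      rw [← spectrum.singleton_sub_eq]
      simp
    rw [hT.posSemidef_iff_eigenvalues_nonneg, ← h, hT.spectrum_real_eq_range_eigenvalues,
      Set.forall_mem_range]
    rfl
  rw [hspec, hpos, posSemidef_iff_dotProduct_mulVec, and_iff_right hT]
  simp [sub_mulVec, Algebra.algebraMap_eq_smul_one, smul_mulVec]

/-- For symmetric `M`, the largest eigenvalue of `diagonal u - M`, shifted by the mean of `u`,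
attains its minimum over `u`. -/
theorem exists_min_lamMax_diagonal {k : Type*} [Fintype k] [DecidableEq k] [Nonempty k]
    {M : Matrix k k ℝ} (hM : M.IsSymm) :
    ∃ v : k → ℝ, ∀ u : k → ℝ,
      lamMax (diagonal v - M - ((∑ i, v i) / Fintype.card k) • (1 : Matrix k k ℝ)) ≤
        lamMax (diagonal u - M - ((∑ i, u i) / Fintype.card k) • (1 : Matrix k k ℝ)) := by
  set B : (k → ℝ) → Matrix k k ℝ := fun u ↦
    diagonal u - M - ((∑ i, u i) / Fintype.card k) • (1 : Matrix k k ℝ) with hB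
  have hcard : (Fintype.card k : ℝ) ≠ 0 := by simp
  have hle (u : k → ℝ) (t : ℝ) :
      lamMax (B u) ≤ t ↔ ∀ x : k → ℝ, x ⬝ᵥ (B u *ᵥ x) ≤ t * (x ⬝ᵥ x) :=
    lamMax_le_iff (((isSymm_diagonal u).sub hM).sub (isSymm_one.smul _)) t
  have hclosed (t : ℝ) : IsClosed {u | lamMax (B u) ≤ t} := by
    simp only [hle, Set.ofPred_forall]
    refine isClosed_iInter fun x ↦ isClosed_le ?_ continuous_const
    simp only [hB]
    fun_prop
  have hlsc : LowerSemicontinuous fun u ↦ lamMax (B u) :=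
    lowerSemicontinuous_iff_isClosed_preimage.2 hclosed
  set K : Set (k → ℝ) := {u | ∑ i, u i = 0} ∩ {u | lamMax (B u) ≤ lamMax (B 0)}
  have hupper {u : k → ℝ} (hu : u ∈ K) (i : k) : u i ≤ lamMax (B 0) + M i i := by
    have h := (hle u _).1 hu.2 (Pi.single i 1)
    have h0 : ∑ i, u i = 0 := hu.1
    have hBi : B u i i = u i - M i i := by simp [hB, h0]
    simp only [mulVec_single_one, single_one_dotProduct, col_apply, hBi, Pi.single_eq_same,
      mul_one] at h
    linarith
  have hKcompact : IsCompact K := by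
    set b : k → ℝ := fun i ↦ lamMax (B 0) + M i i
    refine (isCompact_Icc (a := fun i ↦ b i - ∑ j, b j) (b := b)).of_isClosed_subset
      ((isClosed_eq (by fun_prop) continuous_const).inter (hclosed _)) fun u hu ↦
        ⟨fun i ↦ ?_, hupper hu⟩
    have h0 : ∑ i, u i = 0 := hu.1
    have h : b i - u i ≤ ∑ j, (b j - u j) :=
      Finset.single_le_sum (f := fun j ↦ b j - u j)
        (fun j _ ↦ sub_nonneg.2 (hupper hu j)) (Finset.mem_univ i)
    rw [Finset.sum_sub_distrib, h0] at h
    change b i - ∑ j, b j ≤ u i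
    linarith
  have hK0 : (0 : k → ℝ) ∈ K := ⟨by simp, le_refl (lamMax (B 0))⟩
  obtain ⟨v, -, hv⟩ := (hlsc.lowerSemicontinuousOn K).exists_isMinOn ⟨0, hK0⟩ hKcompact
  refine ⟨v, fun u ↦ ?_⟩
  change lamMax (B v) ≤ lamMax (B u)
  set w : k → ℝ := fun i ↦ u i - (∑ j, u j) / Fintype.card k with hw
  have hw0 : ∑ i, w i = 0 := by
    simp [hw, Finset.sum_sub_distrib, mul_div_cancel₀ _ hcard]
  have hBw : B w = B u := by
    simp only [hB, hw0]
    ext i j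
    by_cases hij : i = j
    · subst hij
      simp [hw]
      ring
    · simp [hij]
  rw [← hBw]
  by_cases h : lamMax (B w) ≤ lamMax (B 0)
  · exact hv ⟨hw0, h⟩
  · exact (hv hK0).trans (not_le.1 h).le

/-- The dual function `θ` admits a minimizer. -/
theorem theta_has_minimizer {m n : ℕ} (A : Matrix (Fin m) (Fin n) ℝ) (y : Fin m → ℝ)
    (ν : ℝ) (hν : 0 ≤ ν) (P : Matrix (Fin n) (Fin n) ℝ) (hP : P.IsSymm) :
    ∃ ustar : Fin n ⊕ Unit → ℝ, ∀ u : Fin n ⊕ Unit → ℝ,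
      theta A y ν P ustar ≤ theta A y ν P u := by
  obtain ⟨v, hv⟩ := exists_min_lamMax_diagonal (isSymm_Mmat A y ν hP)
  refine ⟨v, fun u ↦ mul_le_mul_of_nonneg_left ?_ (by positivity)⟩
  simpa [Amat, dotProduct] using hv u
end
end

section
/- The function η(v) = (n+1)·λmax(D(v) − M) is coercive on the hyperplane of zero-sum vectors: for every sequence (v^k) in ℝ^{n+1} with ∑_{i=1}^{n+1} v^k_i = 0 for all k and ‖v^k‖ → +∞, one has η(v^k) → +∞. -/
open Matrix

noncomputable section

/-- The function `η(v) = (n+1)·λmax(D(v) − M)`. -/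
def eta {n : ℕ} (M : Matrix (Fin (n + 1)) (Fin (n + 1)) ℝ) (v : Fin (n + 1) → ℝ) : ℝ :=
  (n + 1 : ℝ) * lamMax (Matrix.diagonal v - M)

/-- A diagonal entry of a real symmetric matrix is at most its largest eigenvalue. -/
theorem diag_le_lamMax {k : Type*} [Fintype k] [DecidableEq k] {S : Matrix k k ℝ}
    (hS : S.IsSymm) (i : k) : S i i ≤ lamMax S := by
  have hpos : (algebraMap ℝ (Matrix k k ℝ) (lamMax S) - S).PosSemidef := by
    rw [Matrix.posSemidef_iff_isHermitian_and_spectrum_nonneg]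
    refine ⟨?_, ?_⟩
    · rw [Matrix.IsHermitian, Matrix.conjTranspose_eq_transpose_of_trivial,
        Matrix.algebraMap_eq_diagonal, Matrix.transpose_sub, Matrix.diagonal_transpose, hS.eq]
    · rw [← spectrum.singleton_sub_eq]
      rintro _ ⟨_, rfl, μ, hμ, rfl⟩
      exact sub_nonneg.2 (le_csSup (Matrix.finite_spectrum S).bddAbove hμ)
  have h := hpos.diag_nonneg (i := i)
  simpa [Matrix.algebraMap_eq_diagonal] using h

/-- On zero-sum vectors, `η` grows at least like half the Euclidean norm. -/
theorem half_norm_sub_le_eta {n : ℕ} {M : Matrix (Fin (n + 1)) (Fin (n + 1)) ℝ}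
    (hM : M.IsSymm) {v : Fin (n + 1) → ℝ} (hv : ∑ i, v i = 0) :
    Real.sqrt (∑ i, v i ^ 2) / 2 - (n + 1) * ∑ j, |M j j| ≤ eta M v := by
  set C := ∑ j, |M j j|
  set L := lamMax (Matrix.diagonal v - M) with hL
  have hle (i) : v i ≤ L + C := by
    have h := diag_le_lamMax ((Matrix.isSymm_diagonal v).sub hM) i
    have hC : |M i i| ≤ C :=
      Finset.single_le_sum (f := fun j => |M j j|) (fun j _ => abs_nonneg _) (Finset.mem_univ i)
    rw [Matrix.sub_apply, Matrix.diagonal_apply_eq, ← hL] at h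
    linarith [le_abs_self (M i i)]
  have hnonneg : 0 ≤ L + C := by
    obtain ⟨i, -, hi⟩ := Finset.exists_le_of_sum_le (f := fun _ => (0 : ℝ)) (g := v)
      Finset.univ_nonempty (by simp [hv])
    exact hi.trans (hle i)
  have habs : ∑ i, |v i| ≤ 2 * (n + 1) * (L + C) :=
    calc ∑ i, |v i| ≤ ∑ i, (2 * (L + C) - v i) :=
          Finset.sum_le_sum fun i _ => abs_le.2 ⟨by linarith, by linarith [hle i]⟩
      _ = 2 * (n + 1) * (L + C) := by
          rw [Finset.sum_sub_distrib, hv]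
          simp
          ring
  have hsqrt : Real.sqrt (∑ i, v i ^ 2) ≤ ∑ i, |v i| := by
    refine Real.sqrt_le_iff.2 ⟨Finset.sum_nonneg fun i _ => abs_nonneg _, ?_⟩
    simpa using Finset.sum_sq_le_sq_sum_of_nonneg (s := Finset.univ) (f := fun i => |v i|)
      fun i _ => abs_nonneg _
  rw [eta, ← hL]
  linarith

/-- `η` is coercive on the hyperplane of zero-sum vectors: for every sequence
`(v^k)` of zero-sum vectors with `‖v^k‖ → +∞`, one has `η(v^k) → +∞`. -/
theorem eta_coercive_on_zero_sum {n : ℕ} (M : Matrix (Fin (n + 1)) (Fin (n + 1)) ℝ)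
    (hM : M.IsSymm) (v : ℕ → (Fin (n + 1) → ℝ)) (hsum : ∀ k, ∑ i, v k i = 0)
    (hnorm : Filter.Tendsto (fun k => Real.sqrt (∑ i, (v k i) ^ 2)) Filter.atTop Filter.atTop) :
    Filter.Tendsto (fun k => eta M (v k)) Filter.atTop Filter.atTop := by
  refine Filter.tendsto_atTop_mono (fun k => half_norm_sub_le_eta hM (hsum k)) ?_
  simpa only [sub_eq_add_neg] using
    Filter.tendsto_atTop_add_const_right _ _ (hnorm.atTop_div_const two_pos)
end
end

section
/- Recovery of an SDP solution from the eigenvalue relaxation: let u* be a minimizer of θ, let E be a real (n+1)×r matrix whose columns form an orthonormal basis of the eigenspace of A(u*) associated with λmax(A(u*)), and let Z be a real symmetric r×r positive semidefinite matrix with trace(Z) = 1 such that (n+1)·diag(EZEᵀ) = trace(EZEᵀ)·e. Then X* = (n+1)·EZEᵀ is positive semidefinite, its diagonal is the all-ones vector e, and trace(−M X*) = (n+1)·λmax(A(u*)) = θ(u*); in particular X* is an optimal solution of the SDP relaxation max{ trace(−MX) : X symmetric positive semidefinite, diag(X) = e }. -/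
open Matrix

noncomputable section

theorem Matrix.IsHermitian.lamMax_smul_one_sub_posSemidef {k : Type*} [Fintype k] [DecidableEq k]
    {S : Matrix k k ℝ} (hS : S.IsHermitian) : (lamMax S • 1 - S).PosSemidef := by
  rw [Matrix.posSemidef_iff_isHermitian_and_spectrum_nonneg]
  refine ⟨Matrix.IsHermitian.sub ?_ hS, fun t ht => ?_⟩
  · exact Matrix.isHermitian_one.smul (IsSelfAdjoint.all _)
  · rw [← Algebra.algebraMap_eq_smul_one, ← spectrum.singleton_sub_eq, Set.singleton_sub] at ht
    obtain ⟨s, hs, rfl⟩ := ht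
    exact sub_nonneg.2 (le_csSup S.finite_real_spectrum.bddAbove hs)

open scoped MatrixOrder in
theorem Matrix.PosSemidef.trace_mul_nonneg {k : Type*} [Fintype k]
    {B X : Matrix k k ℝ} (hB : B.PosSemidef) (hX : X.PosSemidef) : 0 ≤ (B * X).trace := by
  classical
  obtain ⟨C, rfl⟩ := CStarAlgebra.nonneg_iff_eq_star_mul_self.1 hX.nonneg
  rw [Matrix.star_eq_conjTranspose, ← Matrix.mul_assoc, Matrix.trace_mul_comm, ← Matrix.mul_assoc]
  exact (hB.mul_mul_conjTranspose_same C).trace_nonneg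

theorem Mmat_isHermitian {m n : ℕ} (A : Matrix (Fin m) (Fin n) ℝ) (y : Fin m → ℝ) (ν : ℝ)
    {P : Matrix (Fin n) (Fin n) ℝ} (hP : P.IsSymm) : (Mmat A y ν P).IsHermitian := by
  refine Matrix.IsHermitian.fromBlocks ?_ ?_ ?_
  · rw [Matrix.IsHermitian, Matrix.conjTranspose_eq_transpose_of_trivial]
    simp [hP.eq]
  · ext i j
    simp
  · ext i j
    simp

theorem Amat_isHermitian {m n : ℕ} (A : Matrix (Fin m) (Fin n) ℝ) (y : Fin m → ℝ) (ν : ℝ)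
    {P : Matrix (Fin n) (Fin n) ℝ} (hP : P.IsSymm) (u : Fin n ⊕ Unit → ℝ) :
    (Amat A y ν P u).IsHermitian :=
  ((Matrix.isHermitian_diagonal u).sub (Mmat_isHermitian A y ν hP)).sub
    (Matrix.isHermitian_one.smul (IsSelfAdjoint.all _))

theorem trace_eq_of_diag_eq_one {n : ℕ} {X : Matrix (Fin n ⊕ Unit) (Fin n ⊕ Unit) ℝ}
    (hX : ∀ i, X.diag i = 1) : X.trace = n + 1 := by
  simp only [Matrix.trace, hX]
  simp

theorem trace_Amat_mul_of_diag_eq_one {m n : ℕ} (A : Matrix (Fin m) (Fin n) ℝ) (y : Fin m → ℝ)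
    (ν : ℝ) (P : Matrix (Fin n) (Fin n) ℝ) (u : Fin n ⊕ Unit → ℝ)
    {X : Matrix (Fin n ⊕ Unit) (Fin n ⊕ Unit) ℝ} (hX : ∀ i, X.diag i = 1) :
    (Amat A y ν P u * X).trace = (-(Mmat A y ν P) * X).trace := by
  have hn : (n + 1 : ℝ) ≠ 0 := by positivity
  have hd : (Matrix.diagonal u * X).trace = u ⬝ᵥ (fun _ => 1) := by
    simp only [Matrix.trace, Matrix.diag_apply, Matrix.diagonal_mul, dotProduct]
    exact Finset.sum_congr rfl fun i _ => congrArg (u i * ·) (hX i)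
  rw [Amat, Matrix.sub_mul, Matrix.sub_mul, Matrix.trace_sub, Matrix.trace_sub, hd,
    Matrix.smul_mul, Matrix.one_mul, Matrix.trace_smul, trace_eq_of_diag_eq_one hX,
    Matrix.neg_mul, Matrix.trace_neg, smul_eq_mul, div_mul_cancel₀ _ hn]
  ring

/-- Recovery of an SDP solution from the eigenvalue relaxation. If `u*`
minimizes `θ`, the columns of `E` form an orthonormal basis of the top eigenspace of
`A(u*)`, and `Z ⪰ 0` with `trace(Z) = 1` satisfies `(n+1)·diag(EZEᵀ) = trace(EZEᵀ)·e`,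
then `X* = (n+1)·EZEᵀ` is feasible for the SDP relaxation, achieves
`trace(−MX*) = (n+1)·λmax(A(u*)) = θ(u*)`, and is an optimal SDP solution. -/
theorem sdp_solution_from_eigenvalue_relaxation {m n r : ℕ} (A : Matrix (Fin m) (Fin n) ℝ)
    (y : Fin m → ℝ) (ν : ℝ) (hν : 0 ≤ ν) (P : Matrix (Fin n) (Fin n) ℝ) (hP : P.IsSymm)
    (ustar : Fin n ⊕ Unit → ℝ)
    (hmin : ∀ u : Fin n ⊕ Unit → ℝ, theta A y ν P ustar ≤ theta A y ν P u)
    (E : Matrix (Fin n ⊕ Unit) (Fin r) ℝ)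
    (horth : Eᵀ * E = 1)
    (heig : Amat A y ν P ustar * E = lamMax (Amat A y ν P ustar) • E)
    (hspan : ∀ x : Fin n ⊕ Unit → ℝ,
      Amat A y ν P ustar *ᵥ x = lamMax (Amat A y ν P ustar) • x → ∃ c : Fin r → ℝ, x = E *ᵥ c)
    (Z : Matrix (Fin r) (Fin r) ℝ) (hZ : Z.PosSemidef) (hZtr : Z.trace = 1)
    (hopt : ∀ i, (n + 1 : ℝ) * (E * Z * Eᵀ).diag i = (E * Z * Eᵀ).trace) :
    ((n + 1 : ℝ) • (E * Z * Eᵀ)).PosSemidef ∧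
      (∀ i, ((n + 1 : ℝ) • (E * Z * Eᵀ)).diag i = 1) ∧
      ((-(Mmat A y ν P)) * ((n + 1 : ℝ) • (E * Z * Eᵀ))).trace
        = (n + 1 : ℝ) * lamMax (Amat A y ν P ustar) ∧
      (n + 1 : ℝ) * lamMax (Amat A y ν P ustar) = theta A y ν P ustar ∧
      ∀ X : Matrix (Fin n ⊕ Unit) (Fin n ⊕ Unit) ℝ, X.PosSemidef → (∀ i, X.diag i = 1) →
        ((-(Mmat A y ν P)) * X).trace
          ≤ ((-(Mmat A y ν P)) * ((n + 1 : ℝ) • (E * Z * Eᵀ))).trace := by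
  have htr : (E * Z * Eᵀ).trace = 1 := by
    rw [Matrix.trace_mul_comm, ← Matrix.mul_assoc, horth, Matrix.one_mul, hZtr]
  have hdiag : ∀ i, ((n + 1 : ℝ) • (E * Z * Eᵀ)).diag i = 1 := fun i => (hopt i).trans htr
  have hval : ((-(Mmat A y ν P)) * ((n + 1 : ℝ) • (E * Z * Eᵀ))).trace
      = (n + 1 : ℝ) * lamMax (Amat A y ν P ustar) := by
    rw [← trace_Amat_mul_of_diag_eq_one A y ν P ustar hdiag, Matrix.mul_smul, Matrix.mul_assoc E,
      ← Matrix.mul_assoc, heig, Matrix.smul_mul, ← Matrix.mul_assoc, Matrix.trace_smul,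
      Matrix.trace_smul, htr, smul_eq_mul, smul_eq_mul, mul_one]
  refine ⟨?_, hdiag, hval, rfl, fun X hX hXd => ?_⟩
  · have hE := hZ.mul_mul_conjTranspose_same E
    rw [Matrix.conjTranspose_eq_transpose_of_trivial] at hE
    exact hE.smul (by positivity)
  · have h := (Amat_isHermitian A y ν hP ustar).lamMax_smul_one_sub_posSemidef.trace_mul_nonneg hX
    rw [Matrix.sub_mul, Matrix.trace_sub, Matrix.smul_mul, Matrix.one_mul, Matrix.trace_smul,
      trace_eq_of_diag_eq_one hXd, trace_Amat_mul_of_diag_eq_one A y ν P ustar hXd,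
      smul_eq_mul] at h
    rw [hval]
    linarith
end
end

section
/- Extreme eigenvalues of an arrow matrix are strictly outside the diagonal range: let A = [[D(a), b], [bᵀ, c]] be an arrow matrix with a_1 ≤ a_2 ≤ … ≤ a_n and b_i ≠ 0 for all i, and let λ_1 ≤ λ_2 ≤ … ≤ λ_{n+1} be the eigenvalues of A listed in increasing order with multiplicity. Then λ_1 < a_1 and a_n < λ_{n+1}. -/
open Matrix

noncomputable section

/-- The arrow matrix `[[D(a), b], [bᵀ, c]]`. -/
def arrowMat {n : ℕ} (a b : Fin n → ℝ) (c : ℝ) :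
    Matrix (Fin n ⊕ Unit) (Fin n ⊕ Unit) ℝ :=
  Matrix.fromBlocks (Matrix.diagonal a)
    (Matrix.of fun i (_ : Unit) => b i)
    (Matrix.of fun (_ : Unit) j => b j)
    (Matrix.of fun _ _ => c)

/-- A real symmetric matrix with a nonzero off-diagonal entry in row `i` has an eigenvalue
strictly below its `i`-th diagonal entry. -/
theorem exists_mem_spectrum_lt_diag {ι : Type*} [Fintype ι] [DecidableEq ι]
    {A : Matrix ι ι ℝ} (hA : A.IsHermitian) {i j : ι} (hij : A i j ≠ 0) (hne : i ≠ j) :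
    ∃ μ ∈ spectrum ℝ A, μ < A i i := by
  by_contra! h
  have hB : (A - algebraMap ℝ (Matrix ι ι ℝ) (A i i)).IsHermitian :=
    hA.sub (by simp [Matrix.IsHermitian, Matrix.algebraMap_eq_diagonal])
  have hpsd : (A - algebraMap ℝ (Matrix ι ι ℝ) (A i i)).PosSemidef := by
    refine hB.posSemidef_iff_eigenvalues_nonneg.mpr fun k => ?_
    have hk := hB.eigenvalues_mem_spectrum_real k
    rw [← spectrum.sub_singleton_eq, Set.sub_singleton] at hk
    obtain ⟨μ, hμ, hk⟩ := hk
    simpa [← hk] using h μ hμ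
  have hdet := (hpsd.submatrix ![i, j]).det_nonneg
  have hji : A j i = A i j := by simpa using hA.apply i j
  rw [Matrix.det_fin_two] at hdet
  simp [Matrix.algebraMap_matrix_apply, hne, hne.symm, hji] at hdet
  exact absurd hdet (not_le.mpr (mul_self_pos.mpr hij))

/-- A real symmetric matrix with a nonzero off-diagonal entry in row `i` has an eigenvalue
strictly above its `i`-th diagonal entry. -/
theorem exists_mem_spectrum_gt_diag {ι : Type*} [Fintype ι] [DecidableEq ι]
    {A : Matrix ι ι ℝ} (hA : A.IsHermitian) {i j : ι} (hij : A i j ≠ 0) (hne : i ≠ j) :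
    ∃ μ ∈ spectrum ℝ A, A i i < μ := by
  obtain ⟨μ, hμ, hlt⟩ := exists_mem_spectrum_lt_diag hA.neg
    (i := i) (j := j) (by simpa using hij) hne
  rw [← spectrum.neg_eq, Set.mem_neg] at hμ
  exact ⟨-μ, hμ, by simp at hlt; linarith⟩

theorem arrowMat_isHermitian {n : ℕ} (a b : Fin n → ℝ) (c : ℝ) :
    (arrowMat a b c).IsHermitian := by
  refine Matrix.IsHermitian.fromBlocks ?_ ?_ ?_
  · simp [Matrix.IsHermitian]
  · ext; simp
  · ext; simp

/-- extreme eigenvalues of an arrow matrix with nonvanishing arrow entries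
lie strictly outside the range of the diagonal: `λ₁ < a₁` and `aₙ < λ_{n+1}`. The
eigenvalues `λ₁ ≤ … ≤ λ_{n+1}` (with multiplicity) are encoded by the factorization of the
characteristic polynomial together with monotonicity. -/
theorem arrow_extreme_eigenvalues {n : ℕ} (hn : 0 < n) (a b : Fin n → ℝ) (c : ℝ)
    (ha : Monotone a) (hb : ∀ i, b i ≠ 0)
    (lam : Fin (n + 1) → ℝ) (hlam : Monotone lam)
    (hchar : (arrowMat a b c).charpoly = ∏ i, (Polynomial.X - Polynomial.C (lam i))) :
    lam 0 < a ⟨0, hn⟩ ∧ a ⟨n - 1, by omega⟩ < lam (Fin.last n) := by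
  have hspec : ∀ μ ∈ spectrum ℝ (arrowMat a b c), ∃ k, μ = lam k := by
    intro μ hμ
    rw [Matrix.mem_spectrum_iff_isRoot_charpoly, hchar, Polynomial.IsRoot,
      Polynomial.eval_prod, Finset.prod_eq_zero_iff] at hμ
    obtain ⟨k, -, hk⟩ := hμ
    exact ⟨k, by simpa [sub_eq_zero] using hk⟩
  have hA := arrowMat_isHermitian a b c
  have hoff (i : Fin n) : arrowMat a b c (.inl i) (.inr ()) ≠ 0 := by simpa [arrowMat] using hb i
  have hdiag (i : Fin n) : arrowMat a b c (.inl i) (.inl i) = a i := by simp [arrowMat]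
  constructor
  · obtain ⟨μ, hμ, hlt⟩ := exists_mem_spectrum_lt_diag hA (hoff ⟨0, hn⟩) Sum.inl_ne_inr
    obtain ⟨k, rfl⟩ := hspec μ hμ
    exact (hlam (Fin.zero_le k)).trans_lt (hdiag _ ▸ hlt)
  · obtain ⟨μ, hμ, hlt⟩ := exists_mem_spectrum_gt_diag hA (hoff ⟨n - 1, by omega⟩) Sum.inl_ne_inr
    obtain ⟨k, rfl⟩ := hspec μ hμ
    exact (hdiag _ ▸ hlt).trans_le (hlam (Fin.le_last k))
end
end

section
/- Interlacing of arrow matrix eigenvalues with its diagonal: let A = [[D(a), b], [bᵀ, c]] be an arrow matrix with a_1 ≤ a_2 ≤ … ≤ a_n and b_i ≠ 0 for all i, and let λ_1 ≤ λ_2 ≤ … ≤ λ_{n+1} be the eigenvalues of A listed in increasing order with multiplicity. Then for each i = 1,…,n−1: if a_i < a_{i+1} then a_i < λ_{i+1} < a_{i+1}, and if a_i = a_{i+1} then λ_{i+1} = a_i. -/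
open Matrix

noncomputable section

/-- If a symmetric form is semidefinite of one sign on a coordinate subspace and of the other sign on
a span of eigenvectors, and the dimensions force these to meet, then they meet in an eigenvector. -/
theorem exists_eigenvector_supported_of_card_lt {ι : Type*} [Fintype ι] [DecidableEq ι]
    {M : Matrix ι ι ℝ} (hM : M.IsHermitian) (s ε : ℝ) (hε : ε ≠ 0) (S T : Finset ι)
    (hcard : Sᶜ.card < T.card)
    (hT : ∀ k ∈ T, ε * (hM.eigenvalues k - s) ≤ 0)
    (hS : ∀ x : ι → ℝ, (∀ j ∉ S, x j = 0) → 0 ≤ ε * (x ⬝ᵥ (M *ᵥ x) - s * (x ⬝ᵥ x))) :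
    ∃ x : ι → ℝ, x ≠ 0 ∧ (∀ j ∉ S, x j = 0) ∧ M *ᵥ x = s • x := by
  set d := hM.eigenvalues
  set U : Matrix ι ι ℝ := hM.eigenvectorUnitary.1
  have hUU : Uᵀ * U = 1 := by
    have := Unitary.coe_star_mul_self hM.eigenvectorUnitary
    rwa [star_eq_conjTranspose, conjTranspose_eq_transpose_of_trivial] at this
  have hMU : M * U = U * diagonal d := by
    have h := hM.spectral_theorem
    rw [Unitary.conjStarAlgAut_apply] at h
    conv_lhs => rw [h]
    rw [Matrix.mul_assoc, Unitary.coe_star_mul_self, Matrix.mul_one]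
    rfl
  let V : (T → ℝ) →ₗ[ℝ] ((Sᶜ : Finset ι) → ℝ) :=
    (U.submatrix (fun j : (Sᶜ : Finset ι) => (j : ι)) (fun k : T => (k : ι))).mulVecLin
  obtain ⟨y, hyV, hy⟩ := (Submodule.ne_bot_iff _).1
    (LinearMap.ker_ne_bot_of_finrank_lt (f := V) (by
      simpa only [Module.finrank_fintype_fun_eq_card, Fintype.card_coe] using hcard))
  let z : ι → ℝ := fun k => if h : k ∈ T then y ⟨k, h⟩ else 0
  have hz0 : ∀ k ∉ T, z k = 0 := fun k hk => dif_neg hk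
  have hz : z ≠ 0 := by
    intro h
    apply hy
    ext k
    simpa [z] using congrFun h k
  have hinv : Uᵀ *ᵥ (U *ᵥ z) = z := by rw [mulVec_mulVec, hUU, one_mulVec]
  have hsupp : ∀ j ∉ S, (U *ᵥ z) j = 0 := by
    intro j hj
    have h := congrFun (LinearMap.mem_ker.1 hyV) ⟨j, Finset.mem_compl.2 hj⟩
    rw [Pi.zero_apply] at h
    rw [← h]
    simp only [V, mulVecLin_apply, mulVec, dotProduct, submatrix_apply]
    rw [← Finset.sum_subset (Finset.subset_univ T) (fun k _ hk => by rw [hz0 k hk, mul_zero]),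
      ← Finset.sum_coe_sort T]
    exact Finset.sum_congr rfl fun k _ => by simp [z]
  have hMx : M *ᵥ (U *ᵥ z) = U *ᵥ (fun k => d k * z k) := by
    rw [mulVec_mulVec, hMU, ← mulVec_mulVec]
    congr 1
    ext k
    exact mulVec_diagonal d z k
  have hdot : ∀ w, (U *ᵥ z) ⬝ᵥ (U *ᵥ w) = z ⬝ᵥ w := by
    intro w
    rw [dotProduct_mulVec, ← mulVec_transpose, hinv]
  have hsum : 0 ≤ ∑ k, ε * (d k - s) * (z k * z k) := by
    have h := hS _ hsupp
    rw [hMx, hdot, hdot] at h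
    simp only [dotProduct] at h
    rw [Finset.mul_sum, ← Finset.sum_sub_distrib, Finset.mul_sum] at h
    exact h.trans_eq (Finset.sum_congr rfl fun k _ => by ring)
  have hterm : ∀ k ∈ Finset.univ, ε * (d k - s) * (z k * z k) ≤ 0 := by
    intro k _
    by_cases hk : k ∈ T
    · exact mul_nonpos_of_nonpos_of_nonneg (hT k hk) (mul_self_nonneg _)
    · simp [hz0 k hk]
  have hzero := (Finset.sum_eq_zero_iff_of_nonpos hterm).1
    (le_antisymm (Finset.sum_nonpos hterm) hsum)
  refine ⟨U *ᵥ z, fun h => hz ?_, hsupp, ?_⟩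
  · rw [← hinv, h, mulVec_zero]
  · rw [hMx, ← mulVec_smul]
    congr 1
    ext k
    have h := hzero k (Finset.mem_univ k)
    simp only [mul_eq_zero, hε, false_or, or_self] at h
    rcases h with h | h
    · simp [sub_eq_zero.1 h]
    · simp [h]

theorem card_filter_eigenvalues_eq_of_charpoly_eq {ι κ : Type*} [Fintype ι] [DecidableEq ι]
    [Fintype κ] {M : Matrix ι ι ℝ} (hM : M.IsHermitian) (lam : κ → ℝ)
    (hchar : M.charpoly = ∏ i, (Polynomial.X - Polynomial.C (lam i)))
    (p : ℝ → Prop) [DecidablePred p] :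
    (Finset.univ.filter fun k => p (hM.eigenvalues k)).card
      = (Finset.univ.filter fun k => p (lam k)).card := by
  have h : Finset.univ.val.map hM.eigenvalues = Finset.univ.val.map lam := by
    have h1 := hM.roots_charpoly_eq_eigenvalues
    rw [hchar, Polynomial.roots_prod _ _
      (Finset.prod_ne_zero_iff.2 fun i _ => Polynomial.X_sub_C_ne_zero _)] at h1
    simpa using h1.symm
  have h2 := congrArg (Multiset.countP p) h
  rw [Multiset.countP_map, Multiset.countP_map] at h2
  exact h2

theorem arrowMat_mulVec_inl {n : ℕ} (a b : Fin n → ℝ) (c : ℝ) (x : Fin n ⊕ Unit → ℝ)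
    (hx : x (.inr ()) = 0) (j : Fin n) :
    (arrowMat a b c *ᵥ x) (.inl j) = a j * x (.inl j) := by
  simp [arrowMat, mulVec, dotProduct, hx, diagonal_apply]

theorem arrowMat_mulVec_inr {n : ℕ} (a b : Fin n → ℝ) (c : ℝ) (x : Fin n ⊕ Unit → ℝ)
    (hx : x (.inr ()) = 0) :
    (arrowMat a b c *ᵥ x) (.inr ()) = ∑ j, b j * x (.inl j) := by
  simp [arrowMat, mulVec, dotProduct, hx]

/-- If `s` lies weakly on one side of the diagonal entries indexed by `S`, and too many eigenvalues
lie weakly on the other side of `s`, then `s` has an eigenvector supported on `S`. -/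
theorem exists_arrow_eigenvector_supported {n : ℕ} (a b : Fin n → ℝ) (c : ℝ)
    (lam : Fin (n + 1) → ℝ)
    (hchar : (arrowMat a b c).charpoly = ∏ i, (Polynomial.X - Polynomial.C (lam i)))
    (s ε : ℝ) (hε : ε ≠ 0) (S : Finset (Fin n)) (T : Finset (Fin (n + 1)))
    (hcard : n + 1 < S.card + T.card)
    (hT : ∀ k ∈ T, ε * (lam k - s) ≤ 0) (hS : ∀ j ∈ S, 0 ≤ ε * (a j - s)) :
    ∃ x : Fin n → ℝ, x ≠ 0 ∧ (∀ j ∉ S, x j = 0) ∧ (∀ j, (a j - s) * x j = 0) ∧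
      ∑ j, b j * x j = 0 := by
  classical
  have hM := arrowMat_isHermitian a b c
  have hle : T.card ≤ (Finset.univ.filter fun k => ε * (hM.eigenvalues k - s) ≤ 0).card := by
    rw [card_filter_eigenvalues_eq_of_charpoly_eq hM lam hchar fun r => ε * (r - s) ≤ 0]
    exact Finset.card_le_card fun k hk => by simpa using hT k hk
  have hinr : ∀ x : Fin n ⊕ Unit → ℝ, (∀ j ∉ S.map .inl, x j = 0) → x (.inr ()) = 0 :=
    fun x hx => hx _ (by simp)
  obtain ⟨x, hx, hxS, hxs⟩ := exists_eigenvector_supported_of_card_lt hM s ε hε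
    (S.map .inl) (Finset.univ.filter fun k => ε * (hM.eigenvalues k - s) ≤ 0)
    (by
      rw [Finset.card_compl, Finset.card_map, Fintype.card_sum, Fintype.card_fin, Fintype.card_unit]
      have hSn := card_finset_fin_le S
      omega)
    (fun k hk => by simpa using hk)
    (by
      intro x hx
      have h0 := hinr x hx
      have h : ε * (x ⬝ᵥ (arrowMat a b c *ᵥ x) - s * (x ⬝ᵥ x))
          = ∑ j, ε * (a j - s) * (x (.inl j) * x (.inl j)) := by
        simp only [dotProduct, Fintype.sum_sum_type, Finset.univ_unique, Finset.sum_singleton,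
          PUnit.default_eq_unit, h0, zero_mul, add_zero, arrowMat_mulVec_inl a b c x h0]
        rw [Finset.mul_sum, ← Finset.sum_sub_distrib, Finset.mul_sum]
        exact Finset.sum_congr rfl fun j _ => by ring
      rw [h]
      refine Finset.sum_nonneg fun j _ => ?_
      by_cases hj : j ∈ S
      · exact mul_nonneg (hS j hj) (mul_self_nonneg _)
      · rw [hx (.inl j) (by simpa using hj), mul_zero, mul_zero])
  have h0 := hinr x hxS
  refine ⟨fun j => x (.inl j), fun h => hx ?_, fun j hj => hxS _ (by simpa using hj),
    fun j => ?_, ?_⟩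
  · ext (j | j)
    · exact congrFun h j
    · exact h0
  · have h := congrFun hxs (.inl j)
    rw [arrowMat_mulVec_inl a b c x h0, Pi.smul_apply, smul_eq_mul] at h
    rw [sub_mul, h, sub_self]
  · have h := congrFun hxs (.inr ())
    rwa [arrowMat_mulVec_inr a b c x h0, Pi.smul_apply, h0, smul_zero] at h

theorem eq_zero_of_supported_singleton {n : ℕ} {b x : Fin n → ℝ} (hb : ∀ i, b i ≠ 0)
    (hbx : ∑ j, b j * x j = 0) (i : Fin n) (hx : ∀ j ≠ i, x j = 0) : x = 0 := by
  rw [Finset.sum_eq_single i (fun j _ hj => by rw [hx j hj, mul_zero]) (by simp)] at hbx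
  ext j
  by_cases hj : j = i
  · exact hj ▸ (mul_eq_zero.1 hbx).resolve_left (hb i)
  · exact hx j hj

theorem arrow_lower_bound {n : ℕ} (a b : Fin n → ℝ) (c : ℝ)
    (ha : Monotone a) (hb : ∀ i, b i ≠ 0)
    (lam : Fin (n + 1) → ℝ) (hlam : Monotone lam)
    (hchar : (arrowMat a b c).charpoly = ∏ i, (Polynomial.X - Polynomial.C (lam i)))
    (p q : Fin n) (hpq : (p : ℕ) + 1 = q) :
    a p ≤ lam q.castSucc ∧
      (a p < a q → a p < lam q.castSucc) := by
  set s := lam q.castSucc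
  have key : s ≤ a p → ∃ x : Fin n → ℝ, x ≠ 0 ∧
      (∀ j ∉ Finset.Ici p, x j = 0) ∧
      (∀ j, (a j - s) * x j = 0) ∧ ∑ j, b j * x j = 0 := by
    intro hle
    refine exists_arrow_eigenvector_supported a b c lam hchar s 1 one_ne_zero _
      (Finset.Iic q.castSucc) ?_ (fun k hk => ?_) (fun j hj => ?_)
    · simp only [Fin.card_Ici, Fin.card_Iic, Fin.val_castSucc]
      omega
    · linarith [hlam (Finset.mem_Iic.1 hk)]
    · linarith [ha (Finset.mem_Ici.1 hj)]
  refine ⟨?_, ?_⟩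
  · by_contra! h
    obtain ⟨x, hx, hxS, hxs, -⟩ := key h.le
    refine hx (funext fun j => ?_)
    by_cases hj : j ∈ Finset.Ici p
    · exact (mul_eq_zero.1 (hxs j)).resolve_left
        (sub_pos.2 (h.trans_le (ha (Finset.mem_Ici.1 hj)))).ne'
    · exact hxS j hj
  · intro hlt
    by_contra! h
    obtain ⟨x, hx, hxS, hxs, hbx⟩ := key h
    refine hx (eq_zero_of_supported_singleton hb hbx p fun j hj => ?_)
    by_cases hji : j ∈ Finset.Ici p
    · have hle : q ≤ j := by
        simp only [Finset.mem_Ici, Fin.le_def, ne_eq, Fin.ext_iff] at *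
        omega
      exact (mul_eq_zero.1 (hxs j)).resolve_left
        (sub_pos.2 (h.trans_lt (hlt.trans_le (ha hle)))).ne'
    · exact hxS j hji

theorem arrow_upper_bound {n : ℕ} (a b : Fin n → ℝ) (c : ℝ)
    (ha : Monotone a) (hb : ∀ i, b i ≠ 0)
    (lam : Fin (n + 1) → ℝ) (hlam : Monotone lam)
    (hchar : (arrowMat a b c).charpoly = ∏ i, (Polynomial.X - Polynomial.C (lam i)))
    (p q : Fin n) (hpq : (p : ℕ) + 1 = q) :
    lam q.castSucc ≤ a q ∧
      (a p < a q → lam q.castSucc < a q) := by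
  set s := lam q.castSucc
  have key : a q ≤ s → ∃ x : Fin n → ℝ, x ≠ 0 ∧
      (∀ j ∉ Finset.Iic q, x j = 0) ∧
      (∀ j, (a j - s) * x j = 0) ∧ ∑ j, b j * x j = 0 := by
    intro hle
    refine exists_arrow_eigenvector_supported a b c lam hchar s (-1) (by norm_num) _
      (Finset.Ici q.castSucc) ?_ (fun k hk => ?_) (fun j hj => ?_)
    · simp only [Fin.card_Ici, Fin.card_Iic, Fin.val_castSucc]
      omega
    · linarith [hlam (Finset.mem_Ici.1 hk)]
    · linarith [ha (Finset.mem_Iic.1 hj)]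
  refine ⟨?_, ?_⟩
  · by_contra! h
    obtain ⟨x, hx, hxS, hxs, -⟩ := key h.le
    refine hx (funext fun j => ?_)
    by_cases hj : j ∈ Finset.Iic q
    · exact (mul_eq_zero.1 (hxs j)).resolve_left
        (sub_neg.2 ((ha (Finset.mem_Iic.1 hj)).trans_lt h)).ne
    · exact hxS j hj
  · intro hlt
    by_contra! h
    obtain ⟨x, hx, hxS, hxs, hbx⟩ := key h
    refine hx (eq_zero_of_supported_singleton hb hbx q fun j hj => ?_)
    by_cases hji : j ∈ Finset.Iic q
    · have hle : j ≤ p := by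
        simp only [Finset.mem_Iic, Fin.le_def, ne_eq, Fin.ext_iff] at *
        omega
      exact (mul_eq_zero.1 (hxs j)).resolve_left
        (sub_neg.2 (((ha hle).trans_lt hlt).trans_le h)).ne
    · exact hxS j hji

/-- interlacing of the eigenvalues of an arrow matrix (with nonvanishing
arrow entries) with its sorted diagonal: for each `i` with `i + 1 < n` (0-indexed;
`i = 1,…,n−1` in 1-indexed notation), if `a_i < a_{i+1}` then `a_i < λ_{i+1} < a_{i+1}`,
and if `a_i = a_{i+1}` then `λ_{i+1} = a_i`. -/
theorem arrow_interlacing {n : ℕ} (a b : Fin n → ℝ) (c : ℝ)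
    (ha : Monotone a) (hb : ∀ i, b i ≠ 0)
    (lam : Fin (n + 1) → ℝ) (hlam : Monotone lam)
    (hchar : (arrowMat a b c).charpoly = ∏ i, (Polynomial.X - Polynomial.C (lam i)))
    (i : ℕ) (hi : i + 1 < n) :
    (a ⟨i, by omega⟩ < a ⟨i + 1, hi⟩ →
      a ⟨i, by omega⟩ < lam ⟨i + 1, by omega⟩ ∧ lam ⟨i + 1, by omega⟩ < a ⟨i + 1, hi⟩) ∧
    (a ⟨i, by omega⟩ = a ⟨i + 1, hi⟩ → lam ⟨i + 1, by omega⟩ = a ⟨i, by omega⟩) := by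
  have hlow := arrow_lower_bound a b c ha hb lam hlam hchar ⟨i, by omega⟩ ⟨i + 1, hi⟩ rfl
  have hup := arrow_upper_bound a b c ha hb lam hlam hchar ⟨i, by omega⟩ ⟨i + 1, hi⟩ rfl
  exact ⟨fun h => ⟨hlow.2 h, hup.2 h⟩, fun h => le_antisymm (h ▸ hup.1) hlow.1⟩
end
end

section
/- Simplicity of the top eigenvalue via Perron–Frobenius: let S be a real symmetric n×n matrix all of whose off-diagonal entries are strictly negative (S_{ij} < 0 for all i ≠ j). Then for every u ∈ ℝ^n, the largest eigenvalue of the matrix −S + D(u) has a one-dimensional eigenspace (i.e., it is a simple eigenvalue). -/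
open Matrix

noncomputable section

/-- A kernel vector of a positive semidefinite matrix with negative off-diagonal entries
vanishes as soon as one of its coordinates does. -/
theorem Matrix.PosSemidef.eq_zero_of_mulVec_eq_zero_of_offdiag_neg {k : Type*} [Fintype k]
    {M : Matrix k k ℝ} (hM : M.PosSemidef) (hoff : ∀ i j, i ≠ j → M i j < 0)
    {x : k → ℝ} (hx : M *ᵥ x = 0) {i : k} (hi : x i = 0) : x = 0 := by
  set y : k → ℝ := fun j => |x j| with hy
  have hle : y ⬝ᵥ M *ᵥ y ≤ x ⬝ᵥ M *ᵥ x := by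
    simp only [dotProduct, mulVec, Finset.mul_sum]
    refine Finset.sum_le_sum fun a _ => Finset.sum_le_sum fun b _ => ?_
    rcases eq_or_ne a b with rfl | hab
    · exact le_of_eq (by linear_combination M a a * abs_mul_abs_self (x a))
    · have h1 : x a * x b ≤ |x a| * |x b| := by
        rw [← abs_mul]
        exact le_abs_self _
      simp only [hy]
      nlinarith [hoff a b hab]
  have hzero : star y ⬝ᵥ M *ᵥ y = 0 := by
    refine le_antisymm ?_ (hM.dotProduct_mulVec_nonneg y)
    simpa [hx] using hle
  have hMy : M *ᵥ y = 0 := (hM.dotProduct_mulVec_zero_iff y).1 hzero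
  have hterm : ∀ j, M i j * y j ≤ 0 := fun j => by
    rcases eq_or_ne i j with rfl | hij
    · simp [hy, hi]
    · exact mul_nonpos_of_nonpos_of_nonneg (hoff i j hij).le (abs_nonneg _)
  have hall := (Finset.sum_eq_zero_iff_of_nonpos fun j _ => hterm j).1 (congrFun hMy i)
  funext j
  rcases eq_or_ne i j with rfl | hij
  · exact hi
  · simpa [hy, (hoff i j hij).ne] using hall j (Finset.mem_univ j)

/-- The supremum of the spectrum of a nonempty Hermitian real matrix is its greatest element. -/
theorem Matrix.IsHermitian.isGreatest_lamMax {k : Type*} [Fintype k] [DecidableEq k] [Nonempty k]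
    {A : Matrix k k ℝ} (hA : A.IsHermitian) : IsGreatest (spectrum ℝ A) (lamMax A) := by
  have hne : (spectrum ℝ A).Nonempty := by
    rw [hA.spectrum_real_eq_range_eigenvalues]
    exact Set.range_nonempty _
  have hfin : (spectrum ℝ A).Finite := by
    rw [hA.spectrum_real_eq_range_eigenvalues]
    exact Set.finite_range _
  exact ⟨hne.csSup_mem hfin, fun _ h => le_csSup hfin.bddAbove h⟩

/-- For a Hermitian real matrix, `lamMax A • 1 - A` is positive semidefinite. -/
theorem Matrix.IsHermitian.posSemidef_lamMax_sub {k : Type*} [Fintype k] [DecidableEq k]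
    [Nonempty k] {A : Matrix k k ℝ} (hA : A.IsHermitian) :
    (algebraMap ℝ (Matrix k k ℝ) (lamMax A) - A).PosSemidef := by
  rw [posSemidef_iff_isHermitian_and_spectrum_nonneg]
  refine ⟨IsHermitian.sub ?_ hA, ?_⟩
  · rw [algebraMap_eq_diagonal]
    exact isHermitian_diagonal _
  · rw [← spectrum.singleton_sub_eq]
    rintro _ ⟨_, rfl, b, hb, rfl⟩
    exact sub_nonneg.2 (hA.isGreatest_lamMax.2 hb)

/-- simplicity of the top eigenvalue via Perron–Frobenius: if `S` is real
symmetric with all off-diagonal entries strictly negative, then for every `u` the largest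
eigenvalue of `−S + D(u)` has a one-dimensional eigenspace. -/
theorem top_eigenvalue_simple_of_offdiag_neg {n : ℕ} (hn : 0 < n)
    (S : Matrix (Fin n) (Fin n) ℝ) (hS : S.IsSymm)
    (hoff : ∀ i j, i ≠ j → S i j < 0) (u : Fin n → ℝ) :
    Module.finrank ℝ
      (Module.End.eigenspace (Matrix.toLin' (-S + Matrix.diagonal u))
        (lamMax (-S + Matrix.diagonal u))) = 1 := by
  have : Nonempty (Fin n) := ⟨⟨0, hn⟩⟩
  set A := -S + diagonal u with hAdef
  have hA : A.IsHermitian := by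
    have hS' : S.IsHermitian := by rwa [IsHermitian, conjTranspose_eq_transpose_of_trivial]
    exact hS'.neg.add (isHermitian_diagonal u)
  have hneg : ∀ i j, i ≠ j → (algebraMap ℝ (Matrix (Fin n) (Fin n) ℝ) (lamMax A) - A) i j < 0 := by
    intro i j hij
    simpa [hAdef, algebraMap_eq_diagonal, diagonal_apply_ne _ hij] using hoff i j hij
  have hker : ∀ x ∈ Module.End.eigenspace (toLin' A) (lamMax A), ∀ i, x i = 0 → x = 0 := by
    intro x hx i hi
    refine hA.posSemidef_lamMax_sub.eq_zero_of_mulVec_eq_zero_of_offdiag_neg hneg ?_ hi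
    rw [Module.End.mem_eigenspace_iff, toLin'_apply] at hx
    rw [sub_mulVec, hx, Algebra.algebraMap_eq_smul_one, smul_mulVec, one_mulVec, sub_self]
  have hev : Module.End.HasEigenvalue (toLin' A) (lamMax A) := by
    rw [Module.End.hasEigenvalue_iff_mem_spectrum, spectrum_toLin']
    exact hA.isGreatest_lamMax.1
  obtain ⟨v, hv, hv0⟩ := hev.exists_hasEigenvector
  let i : Fin n := ⟨0, hn⟩
  have hvi : v i ≠ 0 := fun h => hv0 (hker v hv i h)
  refine finrank_eq_one_iff'.2 ⟨⟨v, hv⟩, by simpa using hv0, fun w => ⟨w.1 i / v i, ?_⟩⟩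
  ext1
  refine (sub_eq_zero.1 (hker _ (Submodule.sub_mem _ w.2 (Submodule.smul_mem _ (w.1 i / v i) hv))
    i ?_)).symm
  simp [hvi]
end
end
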